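/- arXiv:1209.6365 — 2 statements merged into one kernel-verified Lean document; each statement's English description precedes it below -/
import Mathlib

section
/- The broken circuit complex BC(𝒞) of a semimatroid 𝒞 is vertex-decomposable. -/
/-- A semimatroid on ground type `α`: a nonempty downward-closed collection `Δ` of finite
subsets (a simplicial complex) together with a rank function `r` satisfying the five
semimatroid axioms of Ardila. -/
structure IsSemimatroid {α : Type*} [DecidableEq α] (Δ : Finset α → Prop) (r : Finset α → ℕ) :
    Prop where
  nonempty : ∃ σ, Δ σ
  down_closed : ∀ ⦃σ τ : Finset α⦄, Δ σ → τ ⊆ σ → Δ τ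
  rank_le_card : ∀ ⦃σ⦄, Δ σ → r σ ≤ σ.card
  rank_mono : ∀ ⦃σ τ⦄, Δ σ → Δ τ → σ ⊆ τ → r σ ≤ r τ
  submodular : ∀ ⦃σ τ⦄, Δ σ → Δ τ → Δ (σ ∪ τ) → r (σ ∪ τ) + r (σ ∩ τ) ≤ r σ + r τ
  union_mem : ∀ ⦃σ τ⦄, Δ σ → Δ τ → r σ = r (σ ∩ τ) → Δ (σ ∪ τ)
  exchange : ∀ ⦃σ τ⦄, Δ σ → Δ τ → r σ < r τ → ∃ y ∈ τ \ σ, Δ (insert y σ)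

/-- A circuit of a semimatroid: a dependent face all of whose proper subsets are
independent. -/
def IsCircuit {α : Type*} (Δ : Finset (Finset α)) (r : Finset α → ℕ) (C : Finset α) : Prop :=
  C ∈ Δ ∧ r C < C.card ∧ ∀ X : Finset α, X ⊂ C → r X = X.card

/-- `σ` contains a broken circuit, i.e. a set `C \ {min C}` for some circuit `C`. -/
def HasBrokenCircuit {α : Type*} [LinearOrder α] (Δ : Finset (Finset α)) (r : Finset α → ℕ)
    (σ : Finset α) : Prop :=
  ∃ C : Finset α, IsCircuit Δ r C ∧ ∃ h : C.Nonempty, C.erase (C.min' h) ⊆ σ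

/-- Membership in the broken circuit complex `BC(𝒞)`: a face containing no broken circuit. -/
def InBC {α : Type*} [LinearOrder α] (Δ : Finset (Finset α)) (r : Finset α → ℕ)
    (σ : Finset α) : Prop :=
  σ ∈ Δ ∧ ¬ HasBrokenCircuit Δ r σ

/-- The deletion complex at `e`. -/
def delC {α : Type*} [DecidableEq α] (Δ : Finset (Finset α)) (e : α) : Finset (Finset α) :=
  Δ.filter (fun τ => e ∉ τ)

/-- The link (contraction complex) at `e`. -/
def lkC {α : Type*} [DecidableEq α] (Δ : Finset (Finset α)) (e : α) : Finset (Finset α) :=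
  (Δ.filter (fun τ => e ∈ τ)).image (fun τ => τ.erase e)

/-- `B` is a basis: an independent face maximal among independent faces. -/
def IsSMBasis {α : Type*} (Δ : Finset (Finset α)) (r : Finset α → ℕ) (B : Finset α) : Prop :=
  B ∈ Δ ∧ r B = B.card ∧ ∀ X ∈ Δ, r X = X.card → B ⊆ X → X = B

/-- `F` is a facet (maximal face) of the complex `K`. -/
def IsFacetOf {α : Type*} (K : Finset (Finset α)) (F : Finset α) : Prop :=
  F ∈ K ∧ ∀ G ∈ K, F ⊆ G → F = G

/-- Vertex decomposability of a (finite) simplicial complex: it is void, a simplex, or has a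
shedding vertex `x` such that the deletion and link at `x` are vertex decomposable and every
facet of the deletion is a facet of the complex. -/
inductive VertexDecomposable {α : Type*} [DecidableEq α] : Finset (Finset α) → Prop
  | void : VertexDecomposable ∅
  | simplex (σ : Finset α) : VertexDecomposable σ.powerset
  | shed (K : Finset (Finset α)) (x : α)
      (hdel : VertexDecomposable (delC K x))
      (hlk : VertexDecomposable (lkC K x))
      (hfacet : ∀ F : Finset α, IsFacetOf (delC K x) F → IsFacetOf K F) :
      VertexDecomposable K

open Classical in
/-- The broken circuit complex of a semimatroid, as a finite set of faces. -/
noncomputable def bcFinset {α : Type*} [LinearOrder α] (Δ : Finset (Finset α))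
    (r : Finset α → ℕ) : Finset (Finset α) :=
  Δ.filter (fun σ => ¬ HasBrokenCircuit Δ r σ)

theorem mem_delC {α : Type*} [DecidableEq α] {Δ : Finset (Finset α)} {x : α} {σ : Finset α} :
    σ ∈ delC Δ x ↔ σ ∈ Δ ∧ x ∉ σ := by
  simp [delC]

theorem mem_lkC {α : Type*} [DecidableEq α] {Δ : Finset (Finset α)} {x : α} {σ : Finset α} :
    σ ∈ lkC Δ x ↔ x ∉ σ ∧ insert x σ ∈ Δ := by
  simp only [lkC, Finset.mem_image, Finset.mem_filter]
  constructor
  · rintro ⟨τ, ⟨hτ, hx⟩, rfl⟩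
    exact ⟨Finset.notMem_erase _ _, by rwa [Finset.insert_erase hx]⟩
  · rintro ⟨hx, hσ⟩
    exact ⟨insert x σ, ⟨hσ, Finset.mem_insert_self _ _⟩, Finset.erase_insert hx⟩

theorem mem_bcFinset {α : Type*} [LinearOrder α] {Δ : Finset (Finset α)} {r : Finset α → ℕ}
    {σ : Finset α} : σ ∈ bcFinset Δ r ↔ σ ∈ Δ ∧ ¬ HasBrokenCircuit Δ r σ := by
  simp [bcFinset]

theorem exists_isFacetOf_superset {α : Type*} {K : Finset (Finset α)} {σ : Finset α}
    (hσ : σ ∈ K) : ∃ F, σ ⊆ F ∧ IsFacetOf K F := by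
  obtain ⟨F, hF, hmax⟩ := K.exists_le_maximal hσ
  exact ⟨F, hF, hmax.prop, fun G hG hFG => hmax.eq_of_le hG hFG⟩

/-- A cone with apex `x` over a vertex-decomposable complex is vertex-decomposable. -/
theorem VertexDecomposable.cone {α : Type*} [DecidableEq α] {x : α} {K : Finset (Finset α)}
    (hK : VertexDecomposable K) :
    ∀ L : Finset (Finset α), (∀ σ ∈ K, x ∉ σ) → (∀ σ, σ ∈ L ↔ σ.erase x ∈ K) →
      VertexDecomposable L := by
  induction hK with
  | void =>
    intro L _ hL
    have : L = ∅ := Finset.eq_empty_of_forall_notMem fun σ hσ => by simpa using (hL σ).1 hσ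
    exact this ▸ .void
  | simplex σ =>
    intro L _ hL
    have : L = (insert x σ).powerset := by
      ext τ
      rw [hL, Finset.mem_powerset, Finset.mem_powerset, Finset.subset_insert_iff]
    exact this ▸ .simplex _
  | shed K y hdel hlk hfacet ihdel ihlk =>
    intro L hx hL
    by_cases hyx : y = x
    · subst hyx
      have : delC K y = K := Finset.filter_true_of_mem hx
      rw [this] at ihdel
      exact ihdel L hx hL
    · have hdelL : ∀ σ, σ ∈ delC L y ↔ σ.erase x ∈ delC K y := by
        intro σ
        simp [mem_delC, hL, hyx]
      refine .shed L y (ihdel _ (fun σ hσ => hx σ (mem_delC.1 hσ).1) hdelL)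
        (ihlk _ ?_ ?_) ?_
      · intro σ hσ h
        exact hx _ (mem_lkC.1 hσ).2 (Finset.mem_insert_of_mem h)
      · intro σ
        simp [mem_lkC, hL, hyx, Finset.erase_insert_of_ne hyx]
      · intro F hF
        have hxF : x ∈ F := by
          have h1 : insert x F ∈ delC L y := by
            rw [hdelL, Finset.erase_insert_eq_erase]
            exact (hdelL F).1 hF.1
          rw [hF.2 _ h1 (Finset.subset_insert _ _)]
          exact Finset.mem_insert_self _ _
        have hF' : IsFacetOf (delC K y) (F.erase x) := by
          refine ⟨(hdelL F).1 hF.1, fun G hG hFG => ?_⟩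
          have hxG := hx G (mem_delC.1 hG).1
          have h1 : insert x G ∈ delC L y := by
            rw [hdelL, Finset.erase_insert hxG]
            exact hG
          rw [hF.2 _ h1 (Finset.subset_insert_iff.2 hFG), Finset.erase_insert hxG]
        refine ⟨(mem_delC.1 hF.1).1, fun G hG hFG => ?_⟩
        have h1 := (hfacet _ hF').2 _ ((hL G).1 hG) (Finset.erase_subset_erase x hFG)
        rw [← Finset.insert_erase hxF, h1, Finset.insert_erase (hFG hxF)]

namespace IsSemimatroid

section Rank

variable {α : Type*} [DecidableEq α] {Δ : Finset (Finset α)} {r : Finset α → ℕ}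

theorem empty_mem (h : IsSemimatroid (· ∈ Δ) r) : ∅ ∈ Δ := by
  obtain ⟨σ, hσ⟩ := h.nonempty
  exact h.down_closed hσ (Finset.empty_subset _)

theorem rank_insert_le (h : IsSemimatroid (· ∈ Δ) r) {y : α} {σ : Finset α}
    (hσ : insert y σ ∈ Δ) : r (insert y σ) ≤ r σ + 1 := by
  have hσ' : σ ∈ Δ := h.down_closed hσ (Finset.subset_insert _ _)
  have hy : {y} ∈ Δ := h.down_closed hσ (by simp)
  have h1 := h.submodular hy hσ' (by simpa using hσ)
  have h2 := h.rank_le_card hy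
  simp only [Finset.singleton_union, Finset.card_singleton] at h1 h2
  omega

theorem rank_eq_card_of_subset (h : IsSemimatroid (· ∈ Δ) r) {σ τ : Finset α} (hσ : σ ∈ Δ)
    (hτσ : τ ⊆ σ) (hr : r σ = σ.card) : r τ = τ.card := by
  have hτ : τ ∈ Δ := h.down_closed hσ hτσ
  have hd : σ \ τ ∈ Δ := h.down_closed hσ Finset.sdiff_subset
  have h1 := h.submodular hτ hd (by simpa [Finset.union_sdiff_of_subset hτσ] using hσ)
  rw [Finset.union_sdiff_of_subset hτσ] at h1
  have h2 := h.rank_le_card hτ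
  have h3 := h.rank_le_card hd
  have h4 := Finset.card_sdiff_add_card_eq_card hτσ
  omega

theorem exists_isCircuit_subset (h : IsSemimatroid (· ∈ Δ) r) {σ : Finset α} (hσ : σ ∈ Δ)
    (hr : r σ < σ.card) : ∃ C ⊆ σ, IsCircuit Δ r C := by
  induction σ using Finset.strongInduction with
  | H σ ih =>
    by_cases hX : ∀ X : Finset α, X ⊂ σ → r X = X.card
    · exact ⟨σ, subset_rfl, hσ, hr, hX⟩
    · push Not at hX
      obtain ⟨X, hXσ, hne⟩ := hX
      have hXΔ : X ∈ Δ := h.down_closed hσ hXσ.subset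
      obtain ⟨C, hCX, hC⟩ := ih X hXσ hXΔ (lt_of_le_of_ne (h.rank_le_card hXΔ) hne)
      exact ⟨C, hCX.trans hXσ.subset, hC⟩

theorem exists_rank_insert (h : IsSemimatroid (· ∈ Δ) r) {σ τ : Finset α} (hσ : σ ∈ Δ)
    (hτ : τ ∈ Δ) (hr : r σ < r τ) :
    ∃ y, y ∉ σ ∧ insert y σ ∈ Δ ∧ r (insert y σ) = r σ + 1 := by
  obtain ⟨ρ, hσρ, hmax⟩ := (Δ.filter fun ρ => σ ⊆ ρ ∧ r ρ = r σ).exists_le_maximal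
    (show σ ∈ _ by simp [hσ])
  have hρ := hmax.prop
  simp only [Finset.mem_filter] at hρ
  obtain ⟨hρ, -, hrρ⟩ := hρ
  obtain ⟨y, hy, hyρ⟩ := h.exchange hρ hτ (hrρ ▸ hr)
  rw [Finset.mem_sdiff] at hy
  have hyσ : y ∉ σ := fun hc => hy.2 (hσρ hc)
  have hsub : insert y σ ⊆ insert y ρ := Finset.insert_subset_insert y hσρ
  have hyσΔ : insert y σ ∈ Δ := h.down_closed hyρ hsub
  refine ⟨y, hyσ, hyσΔ, ?_⟩
  have hne : r (insert y ρ) ≠ r σ := by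
    intro he
    have := hmax.eq_of_le (y := insert y ρ)
      (by simp only [Finset.mem_filter]
          exact ⟨hyρ, hσρ.trans (Finset.subset_insert _ _), he⟩) (Finset.subset_insert _ _)
    exact hy.2 (this ▸ Finset.mem_insert_self _ _)
  have hu : ρ ∪ insert y σ = insert y ρ := by
    rw [Finset.union_insert, Finset.union_eq_left.2 hσρ]
  have hi : ρ ∩ insert y σ = σ := by
    rw [Finset.inter_insert_of_notMem hy.2, Finset.inter_eq_right.2 hσρ]
  have h1 := h.submodular hρ hyσΔ (by simpa [hu] using hyρ)
  rw [hu, hi] at h1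
  have h2 := h.rank_mono hρ hyρ (Finset.subset_insert _ _)
  have h3 := h.rank_insert_le hyσΔ
  omega

theorem deletion (h : IsSemimatroid (· ∈ Δ) r) (x : α) : IsSemimatroid (· ∈ delC Δ x) r where
  nonempty := ⟨∅, mem_delC.2 ⟨h.empty_mem, by simp⟩⟩
  down_closed σ τ hσ hτ := by
    rw [mem_delC] at hσ ⊢
    exact ⟨h.down_closed hσ.1 hτ, fun hx => hσ.2 (hτ hx)⟩
  rank_le_card σ hσ := h.rank_le_card (mem_delC.1 hσ).1
  rank_mono σ τ hσ hτ := h.rank_mono (mem_delC.1 hσ).1 (mem_delC.1 hτ).1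
  submodular σ τ hσ hτ hu :=
    h.submodular (mem_delC.1 hσ).1 (mem_delC.1 hτ).1 (mem_delC.1 hu).1
  union_mem σ τ hσ hτ hr := by
    rw [mem_delC] at hσ hτ ⊢
    exact ⟨h.union_mem hσ.1 hτ.1 hr, by simp [hσ.2, hτ.2]⟩
  exchange σ τ hσ hτ hr := by
    rw [mem_delC] at hσ hτ
    obtain ⟨y, hy, hyσ⟩ := h.exchange hσ.1 hτ.1 hr
    refine ⟨y, hy, mem_delC.2 ⟨hyσ, ?_⟩⟩
    rw [Finset.mem_insert, not_or]
    exact ⟨fun he => hτ.2 (he ▸ (Finset.mem_sdiff.1 hy).1), hσ.2⟩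

theorem contraction (h : IsSemimatroid (· ∈ Δ) r) {x : α} (hx : {x} ∈ Δ) (hrx : r {x} = 1) :
    IsSemimatroid (· ∈ lkC Δ x) fun σ => r (insert x σ) - 1 := by
  have hpos : ∀ {σ}, insert x σ ∈ Δ → 1 ≤ r (insert x σ) := fun {σ} hσ =>
    hrx ▸ h.rank_mono hx hσ (by simp)
  refine ⟨⟨∅, mem_lkC.2 ⟨by simp, by simpa using hx⟩⟩, ?_, ?_, ?_, ?_, ?_, ?_⟩
  · intro σ τ hσ hτ
    rw [mem_lkC] at hσ ⊢
    exact ⟨fun hx => hσ.1 (hτ hx), h.down_closed hσ.2 (Finset.insert_subset_insert x hτ)⟩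
  · intro σ hσ
    rw [mem_lkC] at hσ
    have := h.rank_le_card hσ.2
    rw [Finset.card_insert_of_notMem hσ.1] at this
    omega
  · intro σ τ hσ hτ hs
    rw [mem_lkC] at hσ hτ
    have := h.rank_mono hσ.2 hτ.2 (Finset.insert_subset_insert x hs)
    omega
  · intro σ τ hσ hτ hu
    rw [mem_lkC] at hσ hτ hu
    have hi : insert x (σ ∩ τ) ∈ Δ :=
      h.down_closed hσ.2 (Finset.insert_subset_insert x Finset.inter_subset_left)
    have hu' := hu.2
    rw [Finset.insert_union_distrib] at hu'
    have := h.submodular hσ.2 hτ.2 hu'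
    rw [← Finset.insert_union_distrib, ← Finset.insert_inter_distrib] at this
    have h1 := hpos hi
    have h2 := hpos hu.2
    have h3 := hpos hσ.2
    have h4 := hpos hτ.2
    omega
  · intro σ τ hσ hτ hr
    rw [mem_lkC] at hσ hτ ⊢
    have hi : insert x (σ ∩ τ) ∈ Δ :=
      h.down_closed hσ.2 (Finset.insert_subset_insert x Finset.inter_subset_left)
    have h1 := hpos hi
    have h2 := hpos hσ.2
    refine ⟨by simp [hσ.1, hτ.1], ?_⟩
    rw [Finset.insert_union_distrib]
    refine h.union_mem hσ.2 hτ.2 ?_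
    rw [← Finset.insert_inter_distrib]
    omega
  · intro σ τ hσ hτ hr
    rw [mem_lkC] at hσ hτ
    obtain ⟨y, hy, hyσ⟩ := h.exchange hσ.2 hτ.2 (by have := hpos hσ.2; omega)
    simp only [Finset.mem_sdiff, Finset.mem_insert, not_or] at hy
    obtain ⟨hyτ, hyx, hyσ'⟩ := hy
    refine ⟨y, Finset.mem_sdiff.2 ⟨hyτ.resolve_left hyx, hyσ'⟩, mem_lkC.2 ⟨?_, ?_⟩⟩
    · simp [Ne.symm hyx, hσ.1]
    · rwa [Finset.insert_comm]

end Rank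

section BrokenCircuit

variable {α : Type*} [LinearOrder α] {Δ : Finset (Finset α)} {r : Finset α → ℕ}

theorem bcFinset_down_closed (h : IsSemimatroid (· ∈ Δ) r) {σ τ : Finset α}
    (hσ : σ ∈ bcFinset Δ r) (hτ : τ ⊆ σ) : τ ∈ bcFinset Δ r := by
  rw [mem_bcFinset] at hσ ⊢
  refine ⟨h.down_closed hσ.1 hτ, ?_⟩
  rintro ⟨C, hC, hne, hs⟩
  exact hσ.2 ⟨C, hC, hne, hs.trans hτ⟩

theorem rank_eq_card_of_mem_bcFinset (h : IsSemimatroid (· ∈ Δ) r) {σ : Finset α}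
    (hσ : σ ∈ bcFinset Δ r) : r σ = σ.card := by
  rw [mem_bcFinset] at hσ
  by_contra hne
  obtain ⟨C, hCσ, hC⟩ :=
    h.exists_isCircuit_subset hσ.1 (lt_of_le_of_ne (h.rank_le_card hσ.1) hne)
  have hCne : C.Nonempty := Finset.card_pos.1 (by have := hC.2.1; omega)
  exact hσ.2 ⟨C, hC, hCne, (Finset.erase_subset _ _).trans hCσ⟩

/-- A circuit meeting a face in all but at most one of its elements is compatible with it. -/
theorem union_mem_of_isCircuit (h : IsSemimatroid (· ∈ Δ) r) {C σ : Finset α} {c : α}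
    (hC : IsCircuit Δ r C) (hc : c ∈ C) (hσ : σ ∈ Δ) (hs : C.erase c ⊆ σ) : C ∪ σ ∈ Δ := by
  refine h.union_mem hC.1 hσ ?_
  have hi : C ∩ σ ∈ Δ := h.down_closed hσ Finset.inter_subset_right
  have h1 := h.rank_mono (h.down_closed hC.1 (Finset.erase_subset c C)) hi
    (Finset.subset_inter (Finset.erase_subset _ _) hs)
  have h2 := h.rank_mono hi hC.1 Finset.inter_subset_left
  have h3 := hC.2.2 _ (Finset.erase_ssubset hc)
  rw [Finset.card_erase_of_mem hc] at h3
  have := hC.2.1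
  omega

/-- The broken circuit complex is pure. -/
theorem exists_insert_mem_bcFinset (h : IsSemimatroid (· ∈ Δ) r) {F G : Finset α}
    (hF : F ∈ bcFinset Δ r) (hG : G ∈ bcFinset Δ r) (hFG : F.card < G.card) :
    ∃ y, y ∉ F ∧ insert y F ∈ bcFinset Δ r := by
  have hrF := h.rank_eq_card_of_mem_bcFinset hF
  have hrG := h.rank_eq_card_of_mem_bcFinset hG
  have hFb := hF
  rw [mem_bcFinset] at hF hG
  obtain ⟨y₀, hy₀⟩ := h.exists_rank_insert hF.1 hG.1 (by omega)
  let S := (Δ.sup id).filter fun y =>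
    y ∉ F ∧ insert y F ∈ Δ ∧ r (insert y F) = r F + 1
  have hmem : ∀ y, y ∈ S ↔ y ∉ F ∧ insert y F ∈ Δ ∧ r (insert y F) = r F + 1 := by
    intro y
    simp only [S, Finset.mem_filter, Finset.mem_sup, id, and_iff_right_iff_imp]
    exact fun hy => ⟨_, hy.2.1, Finset.mem_insert_self _ _⟩
  obtain ⟨y, hy, hmin⟩ := S.exists_minimal ⟨y₀, (hmem _).2 hy₀⟩
  have hyS := (hmem _).1 hy
  obtain ⟨hyF, hyΔ, hyr⟩ := hyS
  refine ⟨y, hyF, mem_bcFinset.2 ⟨hyΔ, ?_⟩⟩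
  rintro ⟨C, hC, hCne, hs⟩
  set c := C.min' hCne with hc
  have hcC : c ∈ C := C.min'_mem hCne
  have hyc : y ∈ C.erase c := by
    by_contra hyc
    exact hF.2 ⟨C, hC, hCne, (Finset.subset_insert_iff_of_notMem hyc).1 hs⟩
  have hyC := Finset.mem_of_mem_erase hyc
  have hcy : c < y := lt_of_le_of_ne (C.min'_le y hyC) (Finset.ne_of_mem_erase hyc).symm
  have hind : r (insert y F) = (insert y F).card := by
    rw [Finset.card_insert_of_notMem hyF]; omega
  have hCF : ¬ C ⊆ insert y F := fun hsub => by
    have := h.rank_eq_card_of_subset hyΔ hsub hind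
    have := hC.2.1
    omega
  have hcF : c ∉ F := fun hcF => hCF <| by
    rw [← Finset.insert_erase hcC]
    exact Finset.insert_subset (Finset.mem_insert_of_mem hcF) hs
  have hCy : C.erase y ⊆ insert c F := by
    intro z hz
    rw [Finset.mem_erase] at hz
    rw [Finset.mem_insert]
    by_cases hzc : z = c
    · exact .inl hzc
    · exact .inr ((Finset.mem_insert.1 (hs (Finset.mem_erase.2 ⟨hzc, hz.2⟩))).resolve_left hz.1)
  have hu : C ∪ insert y F ∈ Δ := h.union_mem_of_isCircuit hC hcC hyΔ hs
  have hcΔ : insert c F ∈ Δ := h.down_closed hu <| Finset.insert_subset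
    (Finset.mem_union_left _ hcC)
    ((Finset.subset_insert _ _).trans Finset.subset_union_right)
  have hcr : r (insert c F) = r F := by
    have h1 := h.rank_insert_le hcΔ
    have h2 := h.rank_mono hF.1 hcΔ (Finset.subset_insert _ _)
    have h3 : c ∉ S := fun hcS => absurd (hmin hcS hcy.le) (not_le.2 hcy)
    rw [hmem] at h3
    by_contra hne
    exact h3 ⟨hcF, hcΔ, by omega⟩
  have hu' : C ∪ insert c F ∈ Δ := h.down_closed hu <| by
    refine Finset.union_subset Finset.subset_union_left (Finset.insert_subset
      (Finset.mem_union_left _ hcC)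
      ((Finset.subset_insert _ _).trans Finset.subset_union_right))
  have h1 := h.submodular hC.1 hcΔ hu'
  have h2 := h.rank_mono (h.down_closed hC.1 (Finset.erase_subset y C))
    (h.down_closed hC.1 Finset.inter_subset_left)
    (Finset.subset_inter (Finset.erase_subset _ _) hCy)
  have h3 := hC.2.2 _ (Finset.erase_ssubset hyC)
  rw [Finset.card_erase_of_mem hyC] at h3
  have h4 := h.rank_mono hyΔ hu' (Finset.insert_subset (Finset.mem_union_left _ hyC)
    ((Finset.subset_insert _ _).trans Finset.subset_union_right))
  have h5 := hC.2.1
  omega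

theorem rank_singleton (h : IsSemimatroid (· ∈ Δ) r) (hloop : ¬ HasBrokenCircuit Δ r ∅) {x : α}
    (hx : {x} ∈ Δ) : r {x} = 1 := by
  have h1 := h.rank_le_card hx
  rw [Finset.card_singleton] at h1
  by_contra hne
  refine hloop ⟨{x}, ⟨hx, by rw [Finset.card_singleton]; omega, fun X hX => ?_⟩,
    Finset.singleton_nonempty x, by simp⟩
  rw [Finset.ssubset_singleton_iff.1 hX]
  simpa using h.rank_le_card h.empty_mem

theorem min'_ne_of_isCircuit (h : IsSemimatroid (· ∈ Δ) r) (hloop : ¬ HasBrokenCircuit Δ r ∅)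
    {x : α} (hmax : ∀ σ ∈ Δ, ∀ y ∈ σ, y ≤ x) {C : Finset α} (hC : IsCircuit Δ r C)
    (hne : C.Nonempty) : C.min' hne ≠ x := by
  intro he
  have hCx : C = {x} := Finset.eq_singleton_iff_nonempty_unique_mem.2
    ⟨hne, fun y hy => le_antisymm (hmax C hC.1 y hy) (he ▸ C.min'_le y hy)⟩
  have h1 := h.rank_singleton hloop (hCx ▸ hC.1)
  have h2 := hC.2.1
  rw [hCx, h1, Finset.card_singleton] at h2
  exact absurd h2 (lt_irrefl 1)

theorem delC_bcFinset (h : IsSemimatroid (· ∈ Δ) r) (hloop : ¬ HasBrokenCircuit Δ r ∅)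
    {x : α} (hmax : ∀ σ ∈ Δ, ∀ y ∈ σ, y ≤ x) :
    delC (bcFinset Δ r) x = bcFinset (delC Δ x) r := by
  ext σ
  simp only [mem_delC, mem_bcFinset]
  constructor
  · rintro ⟨⟨hσ, hbc⟩, hx⟩
    refine ⟨⟨hσ, hx⟩, ?_⟩
    rintro ⟨C, hC, hne, hs⟩
    exact hbc ⟨C, ⟨(mem_delC.1 hC.1).1, hC.2⟩, hne, hs⟩
  · rintro ⟨⟨hσ, hx⟩, hbc⟩
    refine ⟨⟨hσ, ?_⟩, hx⟩
    rintro ⟨C, hC, hne, hs⟩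
    refine hbc ⟨C, ⟨mem_delC.2 ⟨hC.1, fun hxC => hx (hs ?_)⟩, hC.2⟩, hne, hs⟩
    exact Finset.mem_erase.2 ⟨(h.min'_ne_of_isCircuit hloop hmax hC hne).symm, hxC⟩

theorem lkC_bcFinset (h : IsSemimatroid (· ∈ Δ) r) (hloop : ¬ HasBrokenCircuit Δ r ∅)
    {x : α} (hx : {x} ∈ Δ) (hmax : ∀ σ ∈ Δ, ∀ y ∈ σ, y ≤ x) :
    lkC (bcFinset Δ r) x = bcFinset (lkC Δ x) fun σ => r (insert x σ) - 1 := by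
  have hrx := h.rank_singleton hloop hx
  have hcon := h.contraction hx hrx
  ext σ
  simp only [mem_lkC, mem_bcFinset]
  rw [← and_assoc]
  refine and_congr_right fun ⟨hxσ, hσ⟩ => not_congr ⟨?_, ?_⟩
  · rintro ⟨C, hC, hne, hs⟩
    have hcx := h.min'_ne_of_isCircuit hloop hmax hC hne
    have hu := h.union_mem_of_isCircuit hC (C.min'_mem hne) hσ hs
    have hCx : insert x C ∈ Δ := h.down_closed hu <| Finset.insert_subset
      (Finset.mem_union_right _ (Finset.mem_insert_self _ _)) Finset.subset_union_left
    have hins : insert x (C.erase x) = insert x C := by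
      ext z; by_cases hz : z = x <;> simp [hz]
    have hmem : C.erase x ∈ lkC Δ x := mem_lkC.2 ⟨Finset.notMem_erase _ _, hins ▸ hCx⟩
    have hpos : 1 ≤ r (insert x C) := hrx ▸ h.rank_mono hx hCx (by simp)
    obtain ⟨D, hDC, hD⟩ := hcon.exists_isCircuit_subset hmem <| by
      simp only [hins]
      have h1 := hC.2.1
      by_cases hxC : x ∈ C
      · rw [Finset.insert_eq_of_mem hxC] at hpos ⊢
        rw [Finset.card_erase_of_mem hxC]
        omega
      · have := h.rank_insert_le hCx
        rw [Finset.erase_eq_of_notMem hxC]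
        omega
    have hDne : D.Nonempty := Finset.card_pos.1 (Nat.zero_lt_of_lt hD.2.1)
    refine ⟨D, hD, hDne, fun d hd => ?_⟩
    obtain ⟨hdm, hdD⟩ := Finset.mem_erase.1 hd
    obtain ⟨hdx, hdC⟩ := Finset.mem_erase.1 (hDC hdD)
    have hdc : d ≠ C.min' hne := by
      rintro rfl
      exact hdm (le_antisymm
        (C.min'_le _ (Finset.mem_of_mem_erase (hDC (D.min'_mem hDne)))) (D.min'_le _ hdD))
    exact (Finset.mem_insert.1 (hs (Finset.mem_erase.2 ⟨hdc, hdC⟩))).resolve_left hdx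
  · rintro ⟨D, hD, hDne, hs⟩
    obtain ⟨hxD, hDΔ⟩ := mem_lkC.1 hD.1
    obtain ⟨C, hCD, hC⟩ := h.exists_isCircuit_subset hDΔ <| by
      have : r (insert x D) - 1 < D.card := hD.2.1
      rw [Finset.card_insert_of_notMem hxD]
      omega
    have hCne : C.Nonempty := Finset.card_pos.1 (Nat.zero_lt_of_lt hC.2.1)
    have hle : D.min' hDne ≤ C.min' hCne := by
      rcases Finset.mem_insert.1 (hCD (C.min'_mem hCne)) with he | hmem
      · exact absurd he (h.min'_ne_of_isCircuit hloop hmax hC hCne)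
      · exact D.min'_le _ hmem
    refine ⟨C, hC, hCne, fun z hz => ?_⟩
    obtain ⟨hzc, hzC⟩ := Finset.mem_erase.1 hz
    have hzm : z ≠ D.min' hDne := by
      rintro rfl
      exact hzc (le_antisymm hle (C.min'_le _ hzC))
    rcases Finset.mem_insert.1 (hCD hzC) with hzx | hzD
    · exact hzx ▸ Finset.mem_insert_self _ _
    · exact Finset.mem_insert_of_mem (hs (Finset.mem_erase.2 ⟨hzm, hzD⟩))

/-- If some facet of the deletion of `x` is not a facet of the broken circuit complex, then `x` is
an apex of the broken circuit complex. -/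
theorem mem_bcFinset_iff_erase_of_not_isFacetOf (h : IsSemimatroid (· ∈ Δ) r)
    (hloop : ¬ HasBrokenCircuit Δ r ∅) {x : α} (hmax : ∀ σ ∈ Δ, ∀ y ∈ σ, y ≤ x)
    {F : Finset α} (hF : IsFacetOf (delC (bcFinset Δ r) x) F)
    (hnF : ¬ IsFacetOf (bcFinset Δ r) F) (σ : Finset α) :
    σ ∈ bcFinset Δ r ↔ σ.erase x ∈ delC (bcFinset Δ r) x := by
  refine ⟨fun hσ => mem_delC.2 ⟨h.bcFinset_down_closed hσ (Finset.erase_subset _ _),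
    Finset.notMem_erase _ _⟩, fun hσ => ?_⟩
  obtain ⟨F', hσF', hF'⟩ := exists_isFacetOf_superset hσ
  have hcard : F'.card ≤ F.card := by
    by_contra! hlt
    have hFd := hF.1
    have hFd' := hF'.1
    rw [h.delC_bcFinset hloop hmax] at hFd hFd'
    obtain ⟨y, hy, hyF⟩ := (h.deletion x).exists_insert_mem_bcFinset hFd hFd' hlt
    rw [← h.delC_bcFinset hloop hmax] at hyF
    exact hy (hF.2 _ hyF (Finset.subset_insert _ _) ▸ Finset.mem_insert_self _ _)
  obtain ⟨G, hG, hFG⟩ : ∃ G ∈ bcFinset Δ r, F ⊂ G := by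
    by_contra! hc
    refine hnF ⟨(mem_delC.1 hF.1).1, fun G hG hFG => ?_⟩
    by_contra hne
    exact hc G hG (lt_of_le_of_ne hFG hne)
  obtain ⟨y, hy, hyF'⟩ := h.exists_insert_mem_bcFinset (mem_delC.1 hF'.1).1 hG
    (hcard.trans_lt (Finset.card_lt_card hFG))
  obtain rfl : x = y := by
    by_contra hxy
    refine hy (hF'.2 _ (mem_delC.2 ⟨hyF', ?_⟩) (Finset.subset_insert _ _) ▸
      Finset.mem_insert_self _ _)
    simp [hxy, (mem_delC.1 hF'.1).2]
  exact h.bcFinset_down_closed hyF' (Finset.subset_insert_iff.2 hσF')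

end BrokenCircuit

end IsSemimatroid

/-- The broken circuit complex `BC(𝒞)` of a semimatroid is
vertex-decomposable. -/
theorem brokenCircuitComplex_vertexDecomposable {α : Type*} [LinearOrder α]
    (Δ : Finset (Finset α)) (r : Finset α → ℕ)
    (h : IsSemimatroid (· ∈ Δ) r) :
    VertexDecomposable (bcFinset Δ r) := by
  induction hn : Δ.card using Nat.strong_induction_on generalizing Δ r with
  | _ n ih =>
    subst hn
    by_cases hloop : HasBrokenCircuit Δ r ∅
    · have : bcFinset Δ r = ∅ := Finset.eq_empty_of_forall_notMem fun σ hσ => by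
        obtain ⟨C, hC, hne, hs⟩ := hloop
        exact (mem_bcFinset.1 hσ).2 ⟨C, hC, hne, hs.trans (Finset.empty_subset _)⟩
      exact this ▸ .void
    rcases (Δ.sup id).eq_empty_or_nonempty with hV | hV
    · have : bcFinset Δ r = (∅ : Finset α).powerset := by
        ext σ
        rw [Finset.mem_powerset, Finset.subset_empty]
        constructor
        · intro hσ
          have : σ ⊆ Δ.sup id := Finset.le_sup (f := id) (mem_bcFinset.1 hσ).1
          rwa [hV, Finset.subset_empty] at this
        · rintro rfl
          exact mem_bcFinset.2 ⟨h.empty_mem, hloop⟩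
      exact this ▸ .simplex _
    · set x := (Δ.sup id).max' hV
      have hmax : ∀ σ ∈ Δ, ∀ y ∈ σ, y ≤ x := fun σ hσ y hy =>
        Finset.le_max' _ _ (Finset.mem_sup.2 ⟨σ, hσ, hy⟩)
      obtain ⟨τ, hτ, hxτ⟩ := Finset.mem_sup.1 ((Δ.sup id).max'_mem hV)
      have hx : {x} ∈ Δ := h.down_closed hτ (Finset.singleton_subset_iff.2 hxτ)
      have hdel : VertexDecomposable (delC (bcFinset Δ r) x) := by
        rw [h.delC_bcFinset hloop hmax]
        refine ih _ (Finset.card_lt_card ?_) _ _ (h.deletion x) rfl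
        exact Finset.filter_ssubset.2 ⟨{x}, hx, by simp⟩
      have hlk : VertexDecomposable (lkC (bcFinset Δ r) x) := by
        rw [h.lkC_bcFinset hloop hx hmax]
        refine ih _ (Finset.card_image_le.trans_lt (Finset.card_lt_card ?_)) _ _
          (h.contraction hx (h.rank_singleton hloop hx)) rfl
        exact Finset.filter_ssubset.2 ⟨∅, h.empty_mem, by simp⟩
      by_cases hfacet : ∀ F, IsFacetOf (delC (bcFinset Δ r) x) F → IsFacetOf (bcFinset Δ r) F
      · exact .shed _ x hdel hlk hfacet
      · push Not at hfacet
        obtain ⟨F, hF, hnF⟩ := hfacet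
        exact hdel.cone _ (fun σ hσ => (mem_delC.1 hσ).2)
          (h.mem_bcFinset_iff_erase_of_not_isFacetOf hloop hmax hF hnF)
end

section
/- Let f: Δ → P be a monotone function with a decision tree T, and suppose there is a function d: P → ℕ such that every p-evasive face σ of T satisfies |σ| = d(p). Then for all p ∈ P and i ∈ ℕ, the number of p-evasive faces of cardinality i equals the relative Betti number β̃_{i−1}(Δ_{≤p}, Δ_{<p}); in particular T is optimal. -/
/-! # STATEMENT 19
Decision trees for monotone functions on simplicial complexes, evasive faces, relative
simplicial Betti numbers, and the optimality criterion (Lemma `simple` of the paper):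
if every `p`-evasive face of a decision tree `T` has cardinality `d(p)`, then the number of
`p`-evasive faces of cardinality `i` equals `β̃_{i−1}(Δ_{≤p}, Δ_{<p})`. -/

/-- Binary element decision trees: leaves are labeled `N` (not a face) or by a value of `P`;
internal nodes are labeled by a ground set element, the left subtree handling the link and
the right subtree handling the deletion. -/
inductive DTree (α P : Type*) where
  | leafN : DTree α P
  | leaf (p : P) : DTree α P
  | node (x : α) (left right : DTree α P) : DTree α P

/-- Running the decision tree on a set `σ`: at a node labeled `x` we query whether `x ∈ σ`,
recursing into the link subtree (on `σ \ {x}`) if so, and into the deletion subtree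
otherwise. The result is the number of queries made together with the label of the leaf
reached (`none` encodes the label `N`). -/
def DTree.run {α P : Type*} [DecidableEq α] : DTree α P → Finset α → ℕ × Option P
  | .leafN, _ => (0, none)
  | .leaf p, _ => (0, some p)
  | .node x l r, σ =>
      if x ∈ σ then ((l.run (σ.erase x)).1 + 1, (l.run (σ.erase x)).2)
      else ((r.run σ).1 + 1, (r.run σ).2)

/-- `IsDT E Δ f T`: `T` is an element decision tree for the monotone function `f` defined on
the complex `Δ` over the ground set `E`. Either `T` is a single leaf, `f` is constant and
`Δ` is the full simplex on `E`; or the root is labeled by `x ∈ E` with `{x} ∉ Δ`, the left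
subtree is the leaf `N` and the right subtree is a decision tree for the deletion `f_{\x}`;
or the root is labeled by `x ∈ E` with `{x} ∈ Δ` and the subtrees are decision trees for
the link `f_{/x}` and the deletion `f_{\x}`. -/
inductive IsDT {α P : Type*} [DecidableEq α] :
    Finset α → (Finset α → Prop) → (Finset α → P) → DTree α P → Prop
  | leaf (E : Finset α) (Δ : Finset α → Prop) (f : Finset α → P) (p : P)
      (hsimplex : ∀ σ ⊆ E, Δ σ) (hconst : ∀ σ ⊆ E, f σ = p) :
      IsDT E Δ f (.leaf p)
  | nodeN (E : Finset α) (Δ : Finset α → Prop) (f : Finset α → P) (x : α)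
      (T : DTree α P) (hx : x ∈ E) (hxΔ : ¬ Δ {x})
      (hdel : IsDT (E.erase x) (fun τ => Δ τ ∧ x ∉ τ) f T) :
      IsDT E Δ f (.node x .leafN T)
  | node (E : Finset α) (Δ : Finset α → Prop) (f : Finset α → P) (x : α)
      (Tl Tr : DTree α P) (hx : x ∈ E) (hxΔ : Δ {x})
      (hlink : IsDT (E.erase x) (fun τ => x ∉ τ ∧ Δ (insert x τ))
        (fun τ => f (insert x τ)) Tl)
      (hdel : IsDT (E.erase x) (fun τ => Δ τ ∧ x ∉ τ) f Tr) :
      IsDT E Δ f (.node x Tl Tr)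

/-- The relative faces of cardinality `i` of a pair of complexes `(K, L)`. -/
def Face {α : Type*} (K L : Finset (Finset α)) (i : ℕ) : Type _ :=
  {σ : Finset α // σ ∈ K ∧ σ ∉ L ∧ σ.card = i}

/-- The boundary of a relative face of cardinality `j+1`, as a relative chain over `ℚ`:
`∂σ = Σ_{x ∈ σ} (−1)^{|{y ∈ σ : y < x}|} (σ \ {x})`, where faces lying in `L` are dropped. -/
noncomputable def bdryVec {α : Type*} [LinearOrder α] (K L : Finset (Finset α)) (j : ℕ)
    (σ : Face K L (j + 1)) : Face K L j →₀ ℚ :=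
  ∑ x ∈ σ.1.attach,
    if h : σ.1.erase x.1 ∈ K ∧ σ.1.erase x.1 ∉ L then
      ((-1 : ℚ)) ^ ((σ.1.filter (fun y => y < x.1)).card) •
        Finsupp.single
          ⟨σ.1.erase x.1, h.1, h.2, by
            rw [Finset.card_erase_of_mem x.2, σ.2.2.2]; omega⟩ 1
    else 0

/-- The simplicial boundary operator on relative chains, from cardinality `j+1` to
cardinality `j`. -/
noncomputable def bdry {α : Type*} [LinearOrder α] (K L : Finset (Finset α)) (j : ℕ) :
    (Face K L (j + 1) →₀ ℚ) →ₗ[ℚ] (Face K L j →₀ ℚ) :=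
  Finsupp.lsum ℚ fun σ => LinearMap.toSpanSingleton ℚ _ (bdryVec K L j σ)

/-- The reduced relative Betti number of the pair `(K, L)` in homological dimension `i − 1`,
i.e. the dimension of the homology of the relative chain complex at the chain group spanned
by the relative faces of cardinality `i` (the empty face of cardinality `0` included, so
this is reduced homology). -/
noncomputable def relBetti {α : Type*} [LinearOrder α] (K L : Finset (Finset α)) : ℕ → ℕ
  | 0 =>
      Module.finrank ℚ (Face K L 0 →₀ ℚ) -
        Module.finrank ℚ (LinearMap.range (bdry K L 0))
  | j + 1 =>
      Module.finrank ℚ (LinearMap.ker (bdry K L j)) -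
        Module.finrank ℚ (LinearMap.range (bdry K L (j + 1)))

/-- The incidence number of `τ` in the simplicial boundary of `σ`. -/
def incidence {α : Type*} [LinearOrder α] (τ σ : Finset α) : ℚ :=
  ∑ x ∈ σ, if σ.erase x = τ then (-1 : ℚ) ^ (σ.filter (fun y => y < x)).card else 0

theorem incidence_ne_zero_iff {α : Type*} [LinearOrder α] (τ σ : Finset α) :
    incidence τ σ ≠ 0 ↔ τ ⊆ σ ∧ σ.card = τ.card + 1 := by
  constructor
  · intro h
    obtain ⟨x, hx, hne⟩ := Finset.exists_ne_zero_of_sum_ne_zero h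
    have hτ : σ.erase x = τ := by
      by_contra hc
      exact hne (if_neg hc)
    subst hτ
    exact ⟨Finset.erase_subset _ _, (Finset.card_erase_add_one hx).symm⟩
  · rintro ⟨hsub, hcard⟩
    obtain ⟨x, hx, rfl⟩ : ∃ x, x ∉ τ ∧ insert x τ = σ := by
      obtain ⟨x, hx⟩ := Finset.card_eq_one.1
        (show (σ \ τ).card = 1 by rw [Finset.card_sdiff_of_subset hsub]; omega)
      have hxm : x ∈ σ \ τ := by simp [hx]
      refine ⟨x, (Finset.mem_sdiff.1 hxm).2, ?_⟩
      rw [Finset.insert_eq, ← hx, Finset.sdiff_union_of_subset hsub]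
    rw [incidence, Finset.sum_eq_single x]
    · simp [Finset.erase_insert hx]
    · intro y hy hyx
      rw [if_neg]
      intro h
      exact hx (h ▸ Finset.mem_erase.2 ⟨hyx.symm, Finset.mem_insert_self _ _⟩)
    · simp

theorem sum_mul_incidence {α : Type*} [LinearOrder α] (s : Finset (Finset α)) (σ : Finset α)
    (g : Finset α → ℚ) (hs : ∀ x ∈ σ, g (σ.erase x) ≠ 0 → σ.erase x ∈ s) :
    ∑ τ ∈ s, g τ * incidence τ σ =
      ∑ x ∈ σ, g (σ.erase x) * (-1 : ℚ) ^ (σ.filter (fun y => y < x)).card := by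
  simp only [incidence, Finset.mul_sum]
  rw [Finset.sum_comm]
  refine Finset.sum_congr rfl fun x hx => ?_
  simp only [mul_ite, mul_zero, Finset.sum_ite_eq]
  split_ifs with h
  · rfl
  · have : g (σ.erase x) = 0 := by
      by_contra hc
      exact h (hs x hx hc)
    simp [this]

theorem sign_erase_swap {α : Type*} [LinearOrder α] {σ : Finset α} {x y : α}
    (hx : x ∈ σ) (hy : y ∈ σ) (hxy : x ≠ y) :
    (-1 : ℚ) ^ ((σ.erase x).filter (fun z => z < y)).card *
        (-1 : ℚ) ^ (σ.filter (fun z => z < x)).card =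
      -((-1 : ℚ) ^ ((σ.erase y).filter (fun z => z < x)).card *
        (-1 : ℚ) ^ (σ.filter (fun z => z < y)).card) := by
  wlog h : x < y generalizing x y
  · rw [this hy hx hxy.symm (lt_of_le_of_ne (not_lt.1 h) hxy.symm), neg_neg]
  have h1 : (σ.erase y).filter (fun z => z < x) = σ.filter (fun z => z < x) := by
    rw [Finset.filter_erase, Finset.erase_eq_of_notMem]
    simp [h.le]
  have h2 : ((σ.erase x).filter (fun z => z < y)).card + 1 =
      (σ.filter (fun z => z < y)).card := by
    rw [Finset.filter_erase]
    exact Finset.card_erase_add_one (Finset.mem_filter.2 ⟨hx, h⟩)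
  rw [h1, ← h2, pow_succ]
  ring

theorem sum_incidence_mul_incidence {α : Type*} [LinearOrder α] (s : Finset (Finset α))
    (ρ σ : Finset α) (hs : ∀ τ, ρ ⊆ τ → τ ⊆ σ → τ ∈ s) :
    ∑ τ ∈ s, incidence ρ τ * incidence τ σ = 0 := by
  rw [sum_mul_incidence s σ (incidence ρ) fun x hx h =>
    hs _ ((incidence_ne_zero_iff _ _).1 h).1 (Finset.erase_subset _ _)]
  simp only [incidence, Finset.sum_mul, ite_mul, zero_mul]
  rw [Finset.sum_sigma']
  refine Finset.sum_involution (fun a _ => ⟨a.2, a.1⟩) ?_ ?_ ?_ ?_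
  · rintro ⟨x, y⟩ h
    simp only [Finset.mem_sigma, Finset.mem_erase] at h
    rw [Finset.erase_right_comm]
    split_ifs
    · rw [sign_erase_swap h.1 h.2.2 h.2.1.symm]
      ring
    · simp
  · rintro ⟨x, y⟩ h _ heq
    simp only [Finset.mem_sigma, Finset.mem_erase] at h
    exact h.2.1 (congrArg Sigma.fst heq)
  · rintro ⟨x, y⟩ h
    simp only [Finset.mem_sigma, Finset.mem_erase] at h ⊢
    exact ⟨h.2.2, h.2.1.symm, h.1⟩
  · rintro ⟨x, y⟩ _
    rfl

instance Face.instFinite {α : Type*} (K L : Finset (Finset α)) (i : ℕ) :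
    Finite (Face K L i) :=
  Set.Finite.to_subtype (K.finite_toSet.subset fun _ h => h.1)

theorem Face.single_apply {α : Type*} [DecidableEq α] {K L : Finset (Finset α)} {j : ℕ}
    (ρ τ : Face K L j) :
    Finsupp.single ρ (1 : ℚ) τ = if ρ.1 = τ.1 then 1 else 0 := by
  classical
  rw [Finsupp.single_apply]
  exact if_congr ⟨congrArg Subtype.val, fun h => Subtype.ext h⟩ rfl rfl

theorem bdryVec_apply {α : Type*} [LinearOrder α] (K L : Finset (Finset α)) (j : ℕ)
    (σ : Face K L (j + 1)) (τ : Face K L j) :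
    bdryVec K L j σ τ = incidence τ.1 σ.1 := by
  rw [bdryVec, incidence, Finsupp.finsetSum_apply, ← Finset.sum_attach σ.1]
  refine Finset.sum_congr rfl fun x _ => ?_
  by_cases hx : σ.1.erase x.1 = τ.1
  · have h : σ.1.erase x.1 ∈ K ∧ σ.1.erase x.1 ∉ L := hx ▸ ⟨τ.2.1, τ.2.2.1⟩
    rw [dif_pos h, if_pos hx, Finsupp.smul_apply]
    refine (congrArg (_ • ·) (Face.single_apply _ τ)).trans ?_
    simp [hx]
  · rw [if_neg hx]
    split_ifs with h
    · rw [Finsupp.smul_apply]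
      refine (congrArg (_ • ·) (Face.single_apply _ τ)).trans ?_
      simp [hx]
    · rfl

theorem bdry_single {α : Type*} [LinearOrder α] (K L : Finset (Finset α)) (j : ℕ)
    (σ : Face K L (j + 1)) :
    bdry K L j (Finsupp.single σ 1) = bdryVec K L j σ := by
  simp [bdry]

theorem bdry_apply {α : Type*} [LinearOrder α] (K L : Finset (Finset α)) (j : ℕ)
    [Fintype (Face K L (j + 1))] (v : Face K L (j + 1) →₀ ℚ) (τ : Face K L j) :
    bdry K L j v τ = ∑ σ, v σ * incidence τ.1 σ.1 := by
  rw [bdry, Finsupp.lsum_apply, Finsupp.sum_fintype _ _ (by simp), Finsupp.finsetSum_apply]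
  simp [bdryVec_apply]

theorem bdry_comp_bdry {α : Type*} [LinearOrder α] (K L : Finset (Finset α))
    (hconv : ∀ ρ τ σ, ρ ⊆ τ → τ ⊆ σ → (ρ ∈ K ∧ ρ ∉ L) → (σ ∈ K ∧ σ ∉ L) → τ ∈ K ∧ τ ∉ L)
    (j : ℕ) : bdry K L j ∘ₗ bdry K L (j + 1) = 0 := by
  classical
  have := Fintype.ofFinite (Face K L (j + 1))
  refine Finsupp.lhom_ext' fun σ => LinearMap.ext_ring (Finsupp.ext fun ρ => ?_)
  simp only [LinearMap.comp_apply, Finsupp.lsingle_apply, bdry_single, bdry_apply,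
    bdryVec_apply, LinearMap.zero_apply, Finsupp.zero_apply]
  have hmem : ∀ τ, τ ∈ (K \ L).filter (fun τ => τ.card = j + 1) ↔
      τ ∈ K ∧ τ ∉ L ∧ τ.card = j + 1 := by
    simp [and_assoc]
  have hsum := sum_mul_incidence ((K \ L).filter (fun τ => τ.card = j + 1)) σ.1
    (incidence ρ.1) (fun x hx h => by
      have h' := (incidence_ne_zero_iff _ _).1 h
      have h'' := hconv _ _ _ h'.1 (Finset.erase_subset _ _) ⟨ρ.2.1, ρ.2.2.1⟩
        ⟨σ.2.1, σ.2.2.1⟩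
      exact (hmem _).2 ⟨h''.1, h''.2, by rw [h'.2, ρ.2.2.2]⟩)
  have hzero := sum_incidence_mul_incidence σ.1.powerset ρ.1 σ.1
    fun τ _ h => Finset.mem_powerset.2 h
  rw [sum_mul_incidence _ _ _ fun x _ _ => Finset.mem_powerset.2 (Finset.erase_subset _ _)]
    at hzero
  rw [hzero] at hsum
  have hface := Finset.sum_subtype (F := (‹Fintype (Face K L (j + 1))› :)) _ hmem
    (fun τ => incidence ρ.1 τ * incidence τ σ.1)
  rw [← hsum, hface]
  exact Finset.sum_congr rfl fun τ _ => mul_comm _ _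

theorem finrank_chains {α : Type*} (K L : Finset (Finset α)) (j : ℕ) :
    Module.finrank ℚ (Face K L j →₀ ℚ) = Nat.card (Face K L j) := by
  have := Fintype.ofFinite (Face K L j)
  rw [Module.finrank_finsupp_self, Nat.card_eq_fintype_card]

theorem finrank_range_bdry_zero_le {α : Type*} [LinearOrder α] (K L : Finset (Finset α)) :
    Module.finrank ℚ (LinearMap.range (bdry K L 0)) ≤ Nat.card (Face K L 0) := by
  rw [← finrank_chains]
  exact Submodule.finrank_le _

theorem finrank_range_bdry_add_finrank_ker_bdry {α : Type*} [LinearOrder α]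
    (K L : Finset (Finset α)) (j : ℕ) :
    Module.finrank ℚ (LinearMap.range (bdry K L j)) +
      Module.finrank ℚ (LinearMap.ker (bdry K L j)) = Nat.card (Face K L (j + 1)) := by
  rw [← finrank_chains]
  exact LinearMap.finrank_range_add_finrank_ker _

theorem finrank_range_bdry_succ_le {α : Type*} [LinearOrder α] (K L : Finset (Finset α))
    (hconv : ∀ ρ τ σ, ρ ⊆ τ → τ ⊆ σ → (ρ ∈ K ∧ ρ ∉ L) → (σ ∈ K ∧ σ ∉ L) → τ ∈ K ∧ τ ∉ L)
    (j : ℕ) :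
    Module.finrank ℚ (LinearMap.range (bdry K L (j + 1))) ≤
      Module.finrank ℚ (LinearMap.ker (bdry K L j)) :=
  Submodule.finrank_mono (LinearMap.range_le_ker_iff.2 (bdry_comp_bdry K L hconv j))

/-- The submatrix of `M` with rows `B` and columns `A` has trivial kernel. -/
def TrivialKernelOn {ι : Type*} (M : ι → ι → ℚ) (A B : Finset ι) : Prop :=
  ∀ v : ι → ℚ, (∀ τ ∈ B, ∑ σ ∈ A, v σ * M τ σ = 0) → ∀ σ ∈ A, v σ = 0

theorem card_filter_le_finrank_range_bdry {α : Type*} [LinearOrder α]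
    (K L A B : Finset (Finset α)) (hA : ∀ σ ∈ A, σ ∈ K ∧ σ ∉ L)
    (hB : ∀ σ ∈ B, σ ∈ K ∧ σ ∉ L)
    (hAB : TrivialKernelOn incidence A B) (j : ℕ) :
    (A.filter (fun σ => σ.card = j + 1)).card ≤
      Module.finrank ℚ (LinearMap.range (bdry K L j)) := by
  classical
  obtain ⟨face, hface⟩ : ∃ face : {σ // σ ∈ A.filter (fun σ => σ.card = j + 1)} →
      Face K L (j + 1), ∀ σ, (face σ).1 = σ.1 :=
    ⟨fun σ => ⟨σ.1, (hA _ (Finset.mem_filter.1 σ.2).1).1,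
      (hA _ (Finset.mem_filter.1 σ.2).1).2, (Finset.mem_filter.1 σ.2).2⟩, fun _ => rfl⟩
  have hli : LinearIndependent ℚ (fun σ => (⟨bdryVec K L j (face σ), _,
      bdry_single K L j (face σ)⟩ : LinearMap.range (bdry K L j))) := by
    refine LinearIndependent.of_comp (LinearMap.range (bdry K L j)).subtype ?_
    rw [Fintype.linearIndependent_iff]
    intro g hg
    have key := hAB (fun σ => if h : σ ∈ A.filter (fun σ => σ.card = j + 1)
      then g ⟨σ, h⟩ else 0) ?_
    · intro σ
      have h := key σ.1 (Finset.mem_filter.1 σ.2).1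
      rwa [dif_pos σ.2] at h
    intro τ hτ
    have hsub : ∑ σ ∈ A, (if h : σ ∈ A.filter (fun σ => σ.card = j + 1)
          then g ⟨σ, h⟩ else 0) * incidence τ σ =
        ∑ σ : {σ // σ ∈ A.filter (fun σ => σ.card = j + 1)},
          g σ * incidence τ σ.1 := by
      rw [← Finset.sum_subset (Finset.filter_subset (fun σ => σ.card = j + 1) A)
        (fun σ _ h => by rw [dif_neg h, zero_mul]), ← Finset.sum_coe_sort]
      exact Finset.sum_congr rfl fun σ _ => by rw [dif_pos σ.2]
    rw [hsub]
    by_cases hcard : τ.card = j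
    · obtain ⟨ρ, hρ⟩ : ∃ ρ : Face K L j, ρ.1 = τ :=
        ⟨⟨τ, (hB τ hτ).1, (hB τ hτ).2, hcard⟩, rfl⟩
      have h := DFunLike.congr_fun hg ρ
      simpa only [Finsupp.finsetSum_apply, Finsupp.smul_apply, smul_eq_mul, bdryVec_apply,
        hface, hρ, Function.comp_apply, Submodule.subtype_apply, Finsupp.zero_apply] using h
    · refine Finset.sum_eq_zero fun σ _ => ?_
      have : incidence τ σ.1 = 0 := by
        by_contra hne
        have h := ((incidence_ne_zero_iff _ _).1 hne).2
        have h' := (Finset.mem_filter.1 σ.2).2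
        omega
      rw [this, mul_zero]
  simpa using hli.fintype_card_le_finrank

theorem card_filter_image_insert {α : Type*} [DecidableEq α] (x : α)
    (A : Finset (Finset α)) (hA : ∀ σ ∈ A, x ∉ σ) (j : ℕ) :
    ((A.image (insert x)).filter (fun σ => σ.card = j)).card =
      (A.filter (fun σ => σ.card + 1 = j)).card := by
  symm
  refine Finset.card_bij (fun σ _ => insert x σ) ?_ ?_ ?_
  · intro σ h
    rw [Finset.mem_filter] at h ⊢
    exact ⟨Finset.mem_image_of_mem _ h.1, by
      rw [Finset.card_insert_of_notMem (hA _ h.1), h.2]⟩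
  · intro σ h τ h' heq
    rw [Finset.mem_filter] at h h'
    rw [← Finset.erase_insert (hA _ h.1), heq, Finset.erase_insert (hA _ h'.1)]
  · intro σ h
    rw [Finset.mem_filter, Finset.mem_image] at h
    obtain ⟨⟨τ, hτ, rfl⟩, hc⟩ := h
    rw [Finset.card_insert_of_notMem (hA _ hτ)] at hc
    exact ⟨τ, Finset.mem_filter.2 ⟨hτ, hc⟩, rfl⟩

theorem TrivialKernelOn.union_image_insert {α : Type*} [DecidableEq α] {x : α}
    {M : Finset α → Finset α → ℚ} {A₀ B₀ A₁ B₁ : Finset (Finset α)}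
    (hA₀ : ∀ σ ∈ A₀, x ∉ σ) (hA₁ : ∀ σ ∈ A₁, x ∉ σ)
    (hM : ∀ τ ∈ B₁, ∀ σ ∈ A₀, M (insert x τ) σ = 0)
    (h₀ : TrivialKernelOn M A₀ B₀)
    (h₁ : TrivialKernelOn (fun τ σ => M (insert x τ) (insert x σ)) A₁ B₁) :
    TrivialKernelOn M (A₀ ∪ A₁.image (insert x)) (B₀ ∪ B₁.image (insert x)) := by
  intro v hv
  have hdisj : Disjoint A₀ (A₁.image (insert x)) := by
    rw [Finset.disjoint_left]
    intro σ h h'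
    obtain ⟨τ, _, rfl⟩ := Finset.mem_image.1 h'
    exact hA₀ _ h (Finset.mem_insert_self _ _)
  have hinj : Set.InjOn (insert x) (A₁ : Set (Finset α)) := by
    intro σ h τ h' heq
    rw [← Finset.erase_insert (hA₁ _ h), heq, Finset.erase_insert (hA₁ _ h')]
  simp only [Finset.sum_union hdisj, Finset.sum_image hinj] at hv
  have hlink : ∀ σ ∈ A₁, v (insert x σ) = 0 := by
    refine h₁ (fun σ => v (insert x σ)) fun τ hτ => ?_
    have h := hv _ (Finset.mem_union_right _ (Finset.mem_image_of_mem _ hτ))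
    rwa [Finset.sum_eq_zero fun σ hσ => by rw [hM τ hτ σ hσ, mul_zero], zero_add] at h
  have hdel : ∀ σ ∈ A₀, v σ = 0 := by
    refine h₀ v fun τ hτ => ?_
    have h := hv _ (Finset.mem_union_left _ hτ)
    rwa [Finset.sum_eq_zero (s := A₁) fun σ hσ => by rw [hlink σ hσ, zero_mul],
      add_zero] at h
  intro σ hσ
  rcases Finset.mem_union.1 hσ with h | h
  · exact hdel σ h
  · obtain ⟨τ, hτ, rfl⟩ := Finset.mem_image.1 h
    exact hlink τ hτ

/-- A decision tree matches the non-evasive faces in each fibre of `f`: the lower faces `B`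
are in dimension-shifting bijection with the upper faces `A`, and the incidence matrix
between them is nonsingular, whatever its nonzero entries are. -/
theorem IsDT.exists_matching {α P : Type*} [DecidableEq α] {E : Finset α}
    {Δ : Finset α → Prop} {f : Finset α → P} {T : DTree α P} (hT : IsDT E Δ f T)
    (hE : ∀ σ, Δ σ → σ ⊆ E) (hdown : ∀ σ, Δ σ → ∀ τ ⊆ σ, Δ τ) (p : P) :
    ∃ A B : Finset (Finset α), Disjoint A B ∧
      (∀ σ, σ ∈ A ∪ B ↔ Δ σ ∧ f σ = p ∧ (T.run σ).1 ≠ E.card) ∧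
      (∀ j, (A.filter (fun σ => σ.card = j)).card =
        (B.filter (fun σ => σ.card + 1 = j)).card) ∧
      ∀ M : Finset α → Finset α → ℚ,
        (∀ τ ⊆ E, ∀ σ ⊆ E, M τ σ ≠ 0 ↔ τ ⊆ σ ∧ σ.card = τ.card + 1) →
        TrivialKernelOn M A B := by
  induction hT with
  | leaf E Δ f q hsimplex hconst =>
    by_cases hq : q = p ∧ E.Nonempty
    · obtain ⟨rfl, x, hx⟩ := hq
      have hnot : ∀ σ ∈ (E.erase x).powerset, x ∉ σ := fun σ hσ h =>
        Finset.notMem_erase x E (Finset.mem_powerset.1 hσ h)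
      refine ⟨(E.erase x).powerset.image (insert x), (E.erase x).powerset, ?_, ?_,
        card_filter_image_insert x _ hnot, ?_⟩
      · rw [Finset.disjoint_left]
        intro σ h h'
        obtain ⟨τ, _, rfl⟩ := Finset.mem_image.1 h
        exact hnot _ h' (Finset.mem_insert_self _ _)
      · intro σ
        rw [Finset.union_comm, ← Finset.powerset_insert, Finset.insert_erase hx,
          Finset.mem_powerset]
        have hcard : E.card ≠ 0 := (Finset.card_pos.2 ⟨x, hx⟩).ne'
        exact ⟨fun h => ⟨hsimplex σ h, hconst σ h, hcard.symm⟩, fun h => hE σ h.1⟩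
      · intro M hM v hv σ hσ
        obtain ⟨τ, hτ, rfl⟩ := Finset.mem_image.1 hσ
        have hsub : ∀ ρ ∈ (E.erase x).powerset, ρ ⊆ E := fun ρ h =>
          (Finset.mem_powerset.1 h).trans (Finset.erase_subset _ _)
        have hsub' : ∀ ρ ∈ (E.erase x).powerset, insert x ρ ⊆ E := fun ρ h =>
          Finset.insert_subset hx (hsub ρ h)
        have h := hv τ hτ
        rw [Finset.sum_eq_single (insert x τ)] at h
        · refine (mul_eq_zero.1 h).resolve_right ?_
          exact (hM _ (hsub _ hτ) _ (hsub' _ hτ)).2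
            ⟨Finset.subset_insert _ _, Finset.card_insert_of_notMem (hnot _ hτ)⟩
        · intro σ' hσ' hne
          obtain ⟨ρ, hρ, rfl⟩ := Finset.mem_image.1 hσ'
          by_contra hc
          obtain ⟨h1, h2⟩ := (hM _ (hsub _ hτ) _ (hsub' _ hρ)).1 (right_ne_zero_of_mul hc)
          rw [Finset.card_insert_of_notMem (hnot _ hρ)] at h2
          have h3 : τ ⊆ ρ := (Finset.subset_insert_iff_of_notMem (hnot _ hτ)).1 h1
          exact hne (by rw [Finset.eq_of_subset_of_card_le h3 (by omega)])
        · exact fun h => absurd hσ h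
    · refine ⟨∅, ∅, by simp, fun σ => ?_, by simp, fun M _ v _ σ h => by simp at h⟩
      simp only [Finset.union_idempotent, Finset.notMem_empty, false_iff]
      rintro ⟨h, rfl, hne⟩
      refine hq ⟨(hconst σ (hE σ h)).symm, Finset.card_pos.1 ?_⟩
      exact Nat.pos_of_ne_zero (Ne.symm hne)
  | nodeN E Δ f x T hx hxΔ hdel ih =>
    have hnot : ∀ σ, Δ σ → x ∉ σ := fun σ h hσ =>
      hxΔ (hdown σ h _ (Finset.singleton_subset_iff.2 hσ))
    obtain ⟨A, B, hd, hmem, hcard, hker⟩ := ih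
      (fun σ h => Finset.subset_erase.2 ⟨hE σ h.1, h.2⟩)
      (fun σ h τ hτ => ⟨hdown σ h.1 τ hτ, fun hx => h.2 (hτ hx)⟩)
    refine ⟨A, B, hd, fun σ => ?_, hcard, fun M hM => hker M fun τ hτ σ hσ =>
      hM τ (hτ.trans (Finset.erase_subset _ _)) σ (hσ.trans (Finset.erase_subset _ _))⟩
    rw [hmem, and_assoc]
    refine and_congr_right fun h => ?_
    rw [DTree.run, if_neg (hnot σ h), ← Finset.card_erase_add_one hx]
    simp [hnot σ h]
  | node E Δ f x Tl Tr hx hxΔ hlink hdel ihl ihd =>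
    obtain ⟨A₀, B₀, hd₀, hmem₀, hcard₀, hker₀⟩ := ihd
      (fun σ h => Finset.subset_erase.2 ⟨hE σ h.1, h.2⟩)
      (fun σ h τ hτ => ⟨hdown σ h.1 τ hτ, fun hx => h.2 (hτ hx)⟩)
    obtain ⟨A₁, B₁, hd₁, hmem₁, hcard₁, hker₁⟩ := ihl
      (fun σ h => Finset.subset_erase.2
        ⟨(Finset.subset_insert x σ).trans (hE _ h.2), h.1⟩)
      (fun σ h τ hτ => ⟨fun hx => h.1 (hτ hx),
        hdown _ h.2 _ (Finset.insert_subset_insert x hτ)⟩)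
    have hA₀ : ∀ σ ∈ A₀, x ∉ σ := fun σ h =>
      ((hmem₀ σ).1 (Finset.mem_union_left _ h)).1.2
    have hB₀ : ∀ σ ∈ B₀, x ∉ σ := fun σ h =>
      ((hmem₀ σ).1 (Finset.mem_union_right _ h)).1.2
    have hA₁ : ∀ σ ∈ A₁, x ∉ σ := fun σ h =>
      ((hmem₁ σ).1 (Finset.mem_union_left _ h)).1.1
    have hB₁' : ∀ σ ∈ B₁, x ∉ σ ∧ Δ (insert x σ) := fun σ h =>
      ((hmem₁ σ).1 (Finset.mem_union_right _ h)).1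
    have hB₁ : ∀ σ ∈ B₁, x ∉ σ := fun σ h => (hB₁' σ h).1
    have himage : ∀ C : Finset (Finset α), (∀ σ ∈ C, x ∉ σ) → ∀ σ,
        σ ∈ C.image (insert x) ↔ x ∈ σ ∧ σ.erase x ∈ C := by
      intro C hC σ
      rw [Finset.mem_image]
      constructor
      · rintro ⟨τ, hτ, rfl⟩
        rw [Finset.erase_insert (hC τ hτ)]
        exact ⟨Finset.mem_insert_self _ _, hτ⟩
      · exact fun h => ⟨_, h.2, Finset.insert_erase h.1⟩
    refine ⟨A₀ ∪ A₁.image (insert x), B₀ ∪ B₁.image (insert x), ?_, fun σ => ?_,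
      fun j => ?_, fun M hM => ?_⟩
    · rw [Finset.disjoint_left] at hd₀ hd₁ ⊢
      intro σ h h'
      rw [Finset.mem_union, himage _ hA₁] at h
      rw [Finset.mem_union, himage _ hB₁] at h'
      rcases h with h | h <;> rcases h' with h' | h'
      · exact hd₀ h h'
      · exact hA₀ _ h h'.1
      · exact hB₀ _ h' h.1
      · exact hd₁ h.2 h'.2
    · have h₀ := hmem₀ σ
      have h₁ := hmem₁ (σ.erase x)
      have hE' := Finset.card_erase_add_one hx
      rw [Finset.mem_union] at h₀ h₁
      simp only [Finset.mem_union, himage _ hA₁, himage _ hB₁, DTree.run]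
      by_cases hσ : x ∈ σ
      · rw [if_pos hσ, ← hE']
        beta_reduce at h₁
        rw [Finset.insert_erase hσ] at h₁
        have hna : σ ∉ A₀ := fun h => hA₀ _ h hσ
        have hnb : σ ∉ B₀ := fun h => hB₀ _ h hσ
        simpa [hσ, hna, hnb] using h₁
      · rw [if_neg hσ, ← hE']
        simpa [hσ] using h₀
    · have hdisj : ∀ (C D : Finset (Finset α)) (q : Finset α → Prop) [DecidablePred q],
          (∀ σ ∈ C, x ∉ σ) →
          ((C ∪ D.image (insert x)).filter q).card =
            (C.filter q).card + ((D.image (insert x)).filter q).card := by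
        intro C D q _ hC
        rw [Finset.filter_union, Finset.card_union_of_disjoint]
        refine Finset.disjoint_filter_filter (Finset.disjoint_left.2 fun σ h h' => ?_)
        obtain ⟨τ, _, rfl⟩ := Finset.mem_image.1 h'
        exact hC _ h (Finset.mem_insert_self _ _)
      rw [hdisj _ _ _ hA₀, hdisj _ _ _ hB₀, hcard₀, card_filter_image_insert x _ hA₁]
      cases j with
      | zero => simp
      | succ j =>
        simp only [Nat.add_right_cancel_iff]
        rw [card_filter_image_insert x _ hB₁, hcard₁]
    · refine TrivialKernelOn.union_image_insert hA₀ hA₁ ?_ (hker₀ M ?_) (hker₁ _ ?_)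
      · intro τ hτ σ hσ
        by_contra hne
        have hσE := hE σ ((hmem₀ σ).1 (Finset.mem_union_left _ hσ)).1.1
        have hsub := ((hM _ (hE _ (hB₁' τ hτ).2) _ hσE).1 hne).1
        exact hA₀ σ hσ (hsub (Finset.mem_insert_self _ _))
      · exact fun τ hτ σ hσ => hM τ (hτ.trans (Finset.erase_subset _ _)) σ
          (hσ.trans (Finset.erase_subset _ _))
      · intro τ hτ σ hσ
        rw [Finset.subset_erase] at hτ hσ
        rw [hM _ (Finset.insert_subset hx hτ.1) _ (Finset.insert_subset hx hσ.1),
          Finset.insert_subset_insert_iff hτ.2, Finset.card_insert_of_notMem hτ.2,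
          Finset.card_insert_of_notMem hσ.2, Nat.add_right_cancel_iff]

open Classical in
/-- Let `f : Δ → P` be monotone with a decision tree `T`, and suppose there is
`d : P → ℕ` such that every `p`-evasive face `σ` (a face on which `T` queries all `|S|`
elements) has `|σ| = d(p) = d(f σ)`. Then for every `p ∈ P` and `i ∈ ℕ`, the number of
`p`-evasive faces of cardinality `i` equals the reduced relative Betti number
`β̃_{i−1}(Δ_{≤p}, Δ_{<p})`; in particular equality holds in the Morse inequalities and `T`
is optimal. -/
theorem evasive_equidimensional_implies_optimal
    {α P : Type*} [Fintype α] [LinearOrder α] [PartialOrder P]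
    (Δ : Finset (Finset α))
    (hdown : ∀ σ ∈ Δ, ∀ τ ⊆ σ, τ ∈ Δ)
    (f : Finset α → P)
    (hmono : ∀ σ ∈ Δ, ∀ τ ∈ Δ, σ ⊆ τ → f σ ≤ f τ)
    (T : DTree α P)
    (hT : IsDT Finset.univ (· ∈ Δ) f T)
    (d : P → ℕ)
    (hd : ∀ σ ∈ Δ, (T.run σ).1 = Fintype.card α → σ.card = d (f σ)) :
    ∀ (p : P) (i : ℕ),
      Nat.card
          {σ : Finset α //
            σ ∈ Δ ∧ f σ = p ∧ σ.card = i ∧ (T.run σ).1 = Fintype.card α} =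
        relBetti (Δ.filter (fun σ => f σ ≤ p)) (Δ.filter (fun σ => f σ < p)) i := by
  intro p i
  set K := Δ.filter (fun σ => f σ ≤ p) with hK
  set L := Δ.filter (fun σ => f σ < p) with hL
  have hKL : ∀ σ, σ ∈ K ∧ σ ∉ L ↔ σ ∈ Δ ∧ f σ = p := by
    intro σ
    simp only [hK, hL, Finset.mem_filter, not_and]
    exact ⟨fun h => ⟨h.1.1, eq_of_le_of_not_lt h.1.2 (h.2 h.1.1)⟩,
      fun h => ⟨⟨h.1, h.2.le⟩, fun _ => h.2.not_lt⟩⟩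
  clear_value K L
  clear hK hL
  have hconv : ∀ ρ τ σ, ρ ⊆ τ → τ ⊆ σ → (ρ ∈ K ∧ ρ ∉ L) → (σ ∈ K ∧ σ ∉ L) →
      τ ∈ K ∧ τ ∉ L := by
    intro ρ τ σ hρτ hτσ hρ hσ
    rw [hKL] at hρ hσ ⊢
    have hτ := hdown σ hσ.1 τ hτσ
    exact ⟨hτ, le_antisymm (hσ.2 ▸ hmono τ hτ σ hσ.1 hτσ)
      (hρ.2 ▸ hmono ρ hρ.1 τ hτ hρτ)⟩
  obtain ⟨A, B, hdisj, hmem, hcard, hker⟩ :=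
    hT.exists_matching (fun σ _ => Finset.subset_univ σ) hdown p
  have hA : ∀ σ ∈ A, σ ∈ K ∧ σ ∉ L := fun σ h => (hKL σ).2 <| by
    have h := (hmem σ).1 (Finset.mem_union_left _ h)
    exact ⟨h.1, h.2.1⟩
  have hB : ∀ σ ∈ B, σ ∈ K ∧ σ ∉ L := fun σ h => (hKL σ).2 <| by
    have h := (hmem σ).1 (Finset.mem_union_right _ h)
    exact ⟨h.1, h.2.1⟩
  have hrank := card_filter_le_finrank_range_bdry K L A B hA hB
    (hker incidence fun τ _ σ _ => incidence_ne_zero_iff τ σ)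
  set ev : ℕ → ℕ := fun i => Nat.card {σ : Finset α //
    σ ∈ Δ ∧ f σ = p ∧ σ.card = i ∧ (T.run σ).1 = Fintype.card α} with hev
  have hcount : ∀ j, Nat.card (Face K L j) = ev j +
      (A.filter (fun σ => σ.card = j)).card + (B.filter (fun σ => σ.card = j)).card := by
    intro j
    have h1 : Nat.card (Face K L j) =
        (Finset.univ.filter fun σ : Finset α =>
          σ ∈ K ∧ σ ∉ L ∧ σ.card = j).card := by
      rw [← Fintype.card_subtype, ← Nat.card_eq_fintype_card]
      rfl
    have h2 : ev j = (Finset.univ.filter fun σ : Finset α =>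
        σ ∈ Δ ∧ f σ = p ∧ σ.card = j ∧ (T.run σ).1 = Fintype.card α).card := by
      rw [← Fintype.card_subtype, ← Nat.card_eq_fintype_card]
    rw [h1, h2, add_assoc, ← Finset.card_union_of_disjoint
      (Finset.disjoint_filter_filter hdisj), ← Finset.filter_union,
      ← Finset.card_union_of_disjoint]
    · congr 1
      ext σ
      rw [Finset.mem_union, Finset.mem_filter, Finset.mem_filter, Finset.mem_filter,
        hmem, ← and_assoc (a := σ ∈ K), hKL, Finset.card_univ]
      have := Finset.mem_univ σ
      tauto
    · rw [Finset.disjoint_left]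
      intro σ h h'
      exact ((hmem σ).1 (Finset.mem_filter.1 h').1).2.2
        (Finset.mem_filter.1 h).2.2.2.2
  have hev0 : ∀ j, j ≠ d p → ev j = 0 := by
    intro j hj
    rw [hev]
    refine Nat.card_eq_zero.2 (Or.inl ⟨fun ⟨σ, h1, h2, h3, h4⟩ => hj ?_⟩)
    rw [← h3, ← h2]
    exact hd σ h1 h4
  have hA0 : (A.filter (fun σ => σ.card = 0)).card = 0 := by
    rw [hcard]
    simp
  have hAB : ∀ j, (A.filter (fun σ => σ.card = j + 1)).card =
      (B.filter (fun σ => σ.card = j)).card := by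
    simp [hcard]
  have hr0 := finrank_range_bdry_zero_le K L
  have hrk := finrank_range_bdry_add_finrank_ker_bdry K L
  have hle := finrank_range_bdry_succ_le K L hconv
  have hrank_eq : ∀ j, Module.finrank ℚ (LinearMap.range (bdry K L j)) =
      (B.filter (fun σ => σ.card = j)).card := by
    have low : ∀ j, j ≠ d p → Module.finrank ℚ (LinearMap.range (bdry K L j)) =
        (B.filter (fun σ => σ.card = j)).card := by
      intro j hj
      have h0 := hev0 j hj
      have h1 := hcount j
      have h2 := hrank j
      rw [hAB] at h2
      cases j with
      | zero => omega
      | succ k =>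
        have h3 := hrank k
        have h4 := hrk k
        have h5 := hle k
        omega
    intro j
    by_cases hj : j = d p
    · have h0 := hev0 (j + 1) (by omega)
      have h1 := hcount (j + 1)
      have h2 := hrank j
      have h3 := hrank (j + 1)
      have h4 := hrk j
      have h5 := hle j
      rw [hAB] at h1 h2 h3
      omega
    · exact low j hj
  change ev i = _
  cases i with
  | zero =>
    rw [relBetti, finrank_chains, hrank_eq, hcount]
    omega
  | succ j =>
    have h1 := hrk j
    have h2 := hrank_eq j
    have h3 := hcount (j + 1)
    have h4 := hAB j
    rw [relBetti, hrank_eq]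
    omega
end
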